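/- Let κ = 1 and let x(·) = (x_1(·),…,x_N(·)) be a Caratheodory solution of the topological bounded-confidence model ẋ = f^t(x) on [0, +∞). Then: (1) for each i there exists x_i^∞ ∈ ℝ^n with lim_{t→+∞} x_i(t) = x_i^∞; (2) for each i there exists j ≠ i with x_i^∞ = x_j^∞; and consequently W(x^∞) = 0, where W(x) = Σ_{i=1}^N min_{j ≠ i} I(‖x_i − x_j‖) and I(r) = ∫_0^r a(s) s ds. -/

import Mathlib

open MeasureTheory Set Filter
open scoped Pointwise

noncomputable section

/-- The state space of `N` agents with opinions in `ℝ^n`. -/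
abbrev St (n N : ℕ) := Fin N → EuclideanSpace ℝ (Fin n)

/-- Caratheodory solution of `ẋ = f(x)` on the set `D`: an absolutely continuous curve
satisfying `x(t) = x(0) + ∫_0^t f(x(s)) ds`. -/
def IsCaratheodorySolutionOn {E : Type*} [NormedAddCommGroup E] [NormedSpace ℝ E]
    [CompleteSpace E] (f : E → E) (x : ℝ → E) (D : Set ℝ) : Prop :=
  LocallyIntegrableOn (fun s => f (x s)) D ∧
    ∀ t ∈ D, x t = x 0 + ∫ s in Ioc (0:ℝ) t, f (x s)

/-- `gamma x i` is the smallest index `j ≠ i` minimizing `‖x j - x i‖`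
(with the junk value `i` in the degenerate case `N = 1`). -/
def gamma {n N : ℕ} (x : St n N) (i : Fin N) : Fin N :=
  if h : (Finset.univ.erase i).Nonempty then
    ((Finset.univ.erase i).filter
      (fun j => ‖x j - x i‖ = (Finset.univ.erase i).inf' h fun j => ‖x j - x i‖)).min'
      (by
        obtain ⟨j, hj, hjd⟩ := Finset.exists_mem_eq_inf' h (fun j => ‖x j - x i‖)
        exact ⟨j, Finset.mem_filter.mpr ⟨hj, hjd.symm⟩⟩)
  else i

/-- The topological bounded-confidence vector field with `κ = 1` neighbour:
`fᵗᵢ(x) = a(‖x_{Γ(i)} - x_i‖)(x_{Γ(i)} - x_i)`. -/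
def ft1 {n N : ℕ} (a : ℝ → ℝ) (x : St n N) : St n N :=
  fun i => a ‖x (gamma x i) - x i‖ • (x (gamma x i) - x i)

/-- `Ifun a r = ∫_0^r a(s) s ds`. -/
def Ifun (a : ℝ → ℝ) (r : ℝ) : ℝ := ∫ s in (0:ℝ)..r, a s * s

/-- The Lyapunov function `W(x) = Σ_i min_{j ≠ i} I(‖x_i - x_j‖)`. -/
def Wfun {n N : ℕ} (a : ℝ → ℝ) (x : St n N) : ℝ :=
  ∑ i, ⨅ j : {j : Fin N // j ≠ i}, Ifun a ‖x i - x (j : Fin N)‖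

/-- The speed `a(r) r` of an agent at distance `r` from its nearest neighbour. -/
def speed (a : ℝ → ℝ) (r : ℝ) : ℝ := a r * r

/-- The distance from agent `i` to its nearest neighbour. -/
def nearestDist {n N : ℕ} (x : St n N) (i : Fin N) : ℝ := ‖x (gamma x i) - x i‖

section NearestNeighbour

variable {n N : ℕ}

lemma nearestDist_nonneg (x : St n N) (i : Fin N) : 0 ≤ nearestDist x i := norm_nonneg _

lemma erase_nonempty (hN : 2 ≤ N) (i : Fin N) :
    ((Finset.univ : Finset (Fin N)).erase i).Nonempty := by
  rw [← Finset.card_pos, Finset.card_erase_of_mem (Finset.mem_univ i), Finset.card_univ,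
    Fintype.card_fin]
  omega

lemma gamma_mem (hN : 2 ≤ N) (x : St n N) (i : Fin N) :
    gamma x i ∈ (Finset.univ.erase i).filter (fun j => ‖x j - x i‖ =
      (Finset.univ.erase i).inf' (erase_nonempty hN i) fun j => ‖x j - x i‖) := by
  rw [gamma, dif_pos (erase_nonempty hN i)]
  exact Finset.min'_mem _ _

lemma gamma_ne (hN : 2 ≤ N) (x : St n N) (i : Fin N) : gamma x i ≠ i :=
  (Finset.mem_erase.1 (Finset.mem_filter.1 (gamma_mem hN x i)).1).1

lemma nearestDist_eq_inf' (hN : 2 ≤ N) (x : St n N) (i : Fin N) :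
    nearestDist x i =
      (Finset.univ.erase i).inf' (erase_nonempty hN i) fun j => ‖x j - x i‖ :=
  (Finset.mem_filter.1 (gamma_mem hN x i)).2

lemma nearestDist_le (hN : 2 ≤ N) (x : St n N) {i j : Fin N} (h : j ≠ i) :
    nearestDist x i ≤ ‖x j - x i‖ := by
  rw [nearestDist_eq_inf' hN]
  exact Finset.inf'_le _ (Finset.mem_erase.2 ⟨h, Finset.mem_univ j⟩)

lemma gamma_le (hN : 2 ≤ N) (x : St n N) {i j : Fin N} (h : j ≠ i)
    (hj : ‖x j - x i‖ = nearestDist x i) : gamma x i ≤ j := by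
  rw [nearestDist_eq_inf' hN] at hj
  rw [gamma, dif_pos (erase_nonempty hN i)]
  exact Finset.min'_le _ _
    (Finset.mem_filter.2 ⟨Finset.mem_erase.2 ⟨h, Finset.mem_univ j⟩, hj⟩)

lemma nearestDist_gamma_le (hN : 2 ≤ N) (x : St n N) (i : Fin N) :
    nearestDist x (gamma x i) ≤ nearestDist x i := by
  have h := nearestDist_le hN x (gamma_ne hN x i).symm
  rwa [norm_sub_rev] at h

lemma lipschitzWith_nearestDist (hN : 2 ≤ N) (i : Fin N) :
    LipschitzWith 2 (fun x : St n N => nearestDist x i) := by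
  refine LipschitzWith.of_le_add_mul 2 fun x y => ?_
  have h1 := nearestDist_le hN x (gamma_ne hN y i)
  have h2 : ‖x (gamma y i) - y (gamma y i)‖ ≤ ‖x - y‖ := norm_le_pi_norm (x - y) _
  have h3 : ‖x i - y i‖ ≤ ‖x - y‖ := norm_le_pi_norm (x - y) _
  have h4 : x (gamma y i) - x i =
      (y (gamma y i) - y i) + ((x (gamma y i) - y (gamma y i)) - (x i - y i)) := by abel
  have h5 := norm_add_le (y (gamma y i) - y i)
    ((x (gamma y i) - y (gamma y i)) - (x i - y i))
  have h6 := norm_sub_le (x (gamma y i) - y (gamma y i)) (x i - y i)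
  rw [← h4] at h5
  rw [dist_eq_norm]
  simp only [nearestDist, NNReal.coe_ofNat] at *
  linarith

lemma lipschitzWith_nearestDist_pi (hN : 2 ≤ N) :
    LipschitzWith 2 (fun x : St n N => nearestDist x) :=
  LipschitzWith.of_dist_le_mul fun x y => by
    rw [dist_pi_le_iff (by positivity)]
    exact fun i => (lipschitzWith_nearestDist hN i).dist_le_mul x y

lemma LipschitzWith.fun_min_same {α : Type*} [PseudoEMetricSpace α] {f g : α → ℝ} {K : NNReal}
    (hf : LipschitzWith K f) (hg : LipschitzWith K g) :
    LipschitzWith K fun y => min (f y) (g y) :=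
  (hf.min hg).weaken (max_self K).le

lemma norm_ft1 {a : ℝ → ℝ} (ha : ∀ r : ℝ, 0 ≤ r → 0 ≤ a r) (x : St n N) (i : Fin N) :
    ‖ft1 a x i‖ = speed a (nearestDist x i) := by
  rw [ft1, norm_smul, Real.norm_of_nonneg (ha _ (norm_nonneg _))]
  rfl

/-- If equal nearest-neighbour distances have equal rates, every agent's rate is bounded either
by its own speed or with the help of a strictly closer agent. -/
lemma rate_dichotomy (hN : 2 ≤ N) (a : ℝ → ℝ) (x : St n N) (D : Fin N → ℝ)
    (hD : ∀ i, D i ≤ -speed a (nearestDist x i) + speed a (nearestDist x (gamma x i)))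
    (hmut : ∀ i, gamma x (gamma x i) = i → D i ≤ -speed a (nearestDist x i))
    (htie : ∀ i k, nearestDist x i = nearestDist x k → D i = D k) (i : Fin N) :
    D i ≤ -speed a (nearestDist x i) ∨ ∃ j, nearestDist x j < nearestDist x i ∧
      D i ≤ -speed a (nearestDist x i) + speed a (nearestDist x j) := by
  let T := Finset.univ.filter fun k => nearestDist x k = nearestDist x i
  by_cases h : ∃ k ∈ T, nearestDist x (gamma x k) < nearestDist x i
  · obtain ⟨k, hk, hlt⟩ := h
    have hk' : nearestDist x k = nearestDist x i := (Finset.mem_filter.1 hk).2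
    refine Or.inr ⟨gamma x k, hlt, ?_⟩
    rw [← htie k i hk', ← hk']
    exact hD k
  · push Not at h
    have hmap : ∀ k ∈ T, gamma x k ∈ T := fun k hk =>
      Finset.mem_filter.2 ⟨Finset.mem_univ _, le_antisymm
        ((nearestDist_gamma_le hN x k).trans_eq (Finset.mem_filter.1 hk).2) (h k hk)⟩
    have hne : T.Nonempty := ⟨i, Finset.mem_filter.2 ⟨Finset.mem_univ _, rfl⟩⟩
    let m := T.min' hne
    have hm : m ∈ T := T.min'_mem hne
    have hs := hmap m hm
    have hm' : nearestDist x m = nearestDist x i := (Finset.mem_filter.1 hm).2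
    have hs' : nearestDist x (gamma x m) = nearestDist x i := (Finset.mem_filter.1 hs).2
    have hback : gamma x (gamma x m) = m := by
      refine le_antisymm (gamma_le hN x (gamma_ne hN x m).symm ?_)
        (T.min'_le _ (hmap _ hs))
      rw [hs', ← hm', norm_sub_rev]
      rfl
    left
    rw [← htie m i hm', ← hm']
    exact hmut m hback

end NearestNeighbour

section Derivatives

lemma HasDerivAt.eq_of_le_of_eq {g h : ℝ → ℝ} {g' h' t : ℝ} (hg : HasDerivAt g g' t)
    (hh : HasDerivAt h h' t) (hle : ∀ s, g s ≤ h s) (heq : g t = h t) : g' = h' := by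
  have hmin : IsLocalMin (fun s => h s - g s) t :=
    Filter.Eventually.of_forall fun s => by
      have := hle s
      simp only
      linarith
  have := hmin.hasDerivAt_eq_zero (hh.sub hg)
  linarith

variable {n N : ℕ}

lemma rate_mul_nearestDist (hN : 2 ≤ N) {x : ℝ → St n N} {v : St n N} {t D : ℝ}
    {i : Fin N} (hx : HasDerivAt x v t) (hD : HasDerivAt (fun s => nearestDist (x s) i) D t) :
    nearestDist (x t) i * D =
      inner ℝ (x t (gamma (x t) i) - x t i) (v (gamma (x t) i) - v i) := by
  have hv := hasDerivAt_pi.1 hx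
  have h1 := ((hv (gamma (x t) i)).sub (hv i)).norm_sq
  have h2 := hD.pow 2
  have := h2.eq_of_le_of_eq h1
    (fun s => pow_le_pow_left₀ (nearestDist_nonneg _ _)
      (nearestDist_le hN (x s) (gamma_ne hN (x t) i)) 2) rfl
  simp only [Pi.sub_apply, Nat.cast_ofNat, Nat.add_one_sub_one, pow_one] at this
  linarith

lemma rate_eq_zero {x : ℝ → St n N} {t D : ℝ} {i : Fin N}
    (hD : HasDerivAt (fun s => nearestDist (x s) i) D t) (h0 : nearestDist (x t) i = 0) :
    D = 0 :=
  ((hasDerivAt_const t (0 : ℝ)).eq_of_le_of_eq hD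
    (fun s => nearestDist_nonneg (x s) i) h0.symm).symm

lemma inner_ft1_self (a : ℝ → ℝ) (x : St n N) (i : Fin N) :
    inner ℝ (x (gamma x i) - x i) (ft1 a x i) =
      nearestDist x i * speed a (nearestDist x i) := by
  rw [ft1, real_inner_smul_right, real_inner_self_eq_norm_sq]
  simp only [nearestDist, speed]
  ring

lemma speed_nonneg {a : ℝ → ℝ} (ha : ∀ r : ℝ, 0 ≤ r → 0 ≤ a r) {r : ℝ} (hr : 0 ≤ r) :
    0 ≤ speed a r := mul_nonneg (ha r hr) hr

lemma rate_le (hN : 2 ≤ N) {a : ℝ → ℝ} (ha : ∀ r : ℝ, 0 ≤ r → 0 ≤ a r)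
    {x : ℝ → St n N} {t D : ℝ} {i : Fin N} (hx : HasDerivAt x (ft1 a (x t)) t)
    (hD : HasDerivAt (fun s => nearestDist (x s) i) D t) :
    D ≤ -speed a (nearestDist (x t) i) + speed a (nearestDist (x t) (gamma (x t) i)) := by
  rcases (nearestDist_nonneg (x t) i).eq_or_lt with h0 | hpos
  · rw [rate_eq_zero hD h0.symm, ← h0]
    have := speed_nonneg ha (nearestDist_nonneg (x t) (gamma (x t) i))
    simpa [speed] using this
  · have h := rate_mul_nearestDist hN hx hD
    rw [inner_sub_right, inner_ft1_self] at h
    have h2 := real_inner_le_norm (x t (gamma (x t) i) - x t i) (ft1 a (x t) (gamma (x t) i))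
    rw [norm_ft1 ha] at h2
    change _ ≤ nearestDist (x t) i * _ at h2
    refine le_of_mul_le_mul_left ?_ hpos
    rw [h, mul_add]
    linarith

lemma rate_le_of_mutual (hN : 2 ≤ N) {a : ℝ → ℝ} (ha : ∀ r : ℝ, 0 ≤ r → 0 ≤ a r)
    {x : ℝ → St n N} {t D : ℝ} {i : Fin N} (hx : HasDerivAt x (ft1 a (x t)) t)
    (hD : HasDerivAt (fun s => nearestDist (x s) i) D t)
    (hmut : gamma (x t) (gamma (x t) i) = i) :
    D ≤ -speed a (nearestDist (x t) i) := by
  rcases (nearestDist_nonneg (x t) i).eq_or_lt with h0 | hpos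
  · rw [rate_eq_zero hD h0.symm, ← h0]
    simp [speed]
  · have h := rate_mul_nearestDist hN hx hD
    have hf : ft1 a (x t) (gamma (x t) i) = -ft1 a (x t) i := by
      rw [ft1, hmut, ft1, norm_sub_rev, ← smul_neg, neg_sub]
    rw [inner_sub_right, hf, inner_neg_right, inner_ft1_self] at h
    refine le_of_mul_le_mul_left ?_ hpos
    have := mul_nonneg hpos.le (speed_nonneg ha (nearestDist_nonneg (x t) i))
    rw [h]
    linarith

end Derivatives

section Lyapunov

variable {N : ℕ}

/-- Geometric weights. -/
def weight (N : ℕ) (k : Fin N) : ℝ := ((2 * N : ℝ)⁻¹) ^ (k : ℕ)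

/-- A weighted sum of distances, with the smaller ones getting the larger weights. -/
def sortedSum (d : Fin N → ℝ) : ℝ :=
  (Finset.univ : Finset (Equiv.Perm (Fin N))).inf' Finset.univ_nonempty
    fun σ => ∑ i, weight N (σ i) * d i

lemma inv_two_mul_pos (k : Fin N) : 0 < ((2 * N : ℝ)⁻¹) := by
  have : 0 < N := k.pos
  positivity

lemma inv_two_mul_le_one (k : Fin N) : ((2 * N : ℝ)⁻¹) ≤ 1 := by
  have : (1 : ℝ) ≤ N := by exact_mod_cast k.pos
  exact inv_le_one_of_one_le₀ (by linarith)

lemma weight_pos (k : Fin N) : 0 < weight N k := pow_pos (inv_two_mul_pos k) _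

lemma weight_le_one (k : Fin N) : weight N k ≤ 1 :=
  pow_le_one₀ (inv_two_mul_pos k).le (inv_two_mul_le_one k)

lemma le_weight (k : Fin N) : ((2 * N : ℝ)⁻¹) ^ N ≤ weight N k :=
  pow_le_pow_of_le_one (inv_two_mul_pos k).le (inv_two_mul_le_one k) k.isLt.le

lemma weight_le_of_lt {k l : Fin N} (h : k < l) :
    weight N l ≤ (2 * N : ℝ)⁻¹ * weight N k := by
  rw [weight, weight, ← pow_succ']
  exact pow_le_pow_of_le_one (inv_two_mul_pos k).le (inv_two_mul_le_one k) h

lemma sortedSum_le (d : Fin N → ℝ) (σ : Equiv.Perm (Fin N)) :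
    sortedSum d ≤ ∑ i, weight N (σ i) * d i :=
  Finset.inf'_le _ (Finset.mem_univ σ)

lemma exists_sortedSum_eq (d : Fin N → ℝ) :
    ∃ σ : Equiv.Perm (Fin N), sortedSum d = ∑ i, weight N (σ i) * d i := by
  obtain ⟨σ, -, h⟩ := Finset.exists_mem_eq_inf' (Finset.univ_nonempty)
    (fun σ : Equiv.Perm (Fin N) => ∑ i, weight N (σ i) * d i)
  exact ⟨σ, h⟩

lemma sortedSum_nonneg {d : Fin N → ℝ} (hd : ∀ i, 0 ≤ d i) : 0 ≤ sortedSum d := by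
  obtain ⟨σ, h⟩ := exists_sortedSum_eq d
  rw [h]
  exact Finset.sum_nonneg fun i _ => mul_nonneg (weight_pos _).le (hd i)

lemma lipschitzWith_sortedSum : LipschitzWith N (sortedSum (N := N)) := by
  refine LipschitzWith.of_le_add_mul _ fun d e => ?_
  obtain ⟨σ, h⟩ := exists_sortedSum_eq e
  rw [h]
  refine (sortedSum_le d σ).trans ?_
  have hterm : ∀ i ∈ Finset.univ,
      weight N (σ i) * d i ≤ weight N (σ i) * e i + dist d e := fun i _ => by
    have h1 : d i - e i ≤ dist d e :=
      (le_abs_self _).trans ((Real.dist_eq _ _).symm.le.trans (dist_le_pi_dist d e i))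
    nlinarith [weight_pos (σ i), weight_le_one (σ i), dist_nonneg (x := d) (y := e)]
  refine (Finset.sum_le_sum hterm).trans ?_
  simp [Finset.sum_add_distrib]

lemma lipschitzWith_sortedSum_nearestDist {n : ℕ} (hN : 2 ≤ N) :
    LipschitzWith (N * 2) (fun y : St n N => sortedSum (nearestDist y)) :=
  (lipschitzWith_sortedSum (N := N)).comp (lipschitzWith_nearestDist_pi hN)

lemma lt_of_sortedSum_eq {d : Fin N → ℝ} {σ : Equiv.Perm (Fin N)}
    (hσ : sortedSum d = ∑ i, weight N (σ i) * d i) {i j : Fin N} (h : d j < d i) :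
    σ j < σ i := by
  by_contra hcon
  have hij : i ≠ j := by rintro rfl; exact h.false
  have hlt : σ i < σ j := lt_of_le_of_ne (not_lt.1 hcon) fun e => hij (σ.injective e)
  have hw : weight N (σ j) < weight N (σ i) := by
    have h1 := weight_le_of_lt hlt
    have h2 : ((2 * N : ℝ)⁻¹) < 1 := by
      have : (1 : ℝ) ≤ N := by exact_mod_cast i.pos
      exact inv_lt_one_of_one_lt₀ (by linarith)
    nlinarith [weight_pos (σ i)]
  have hle := sortedSum_le d (σ * Equiv.swap i j)
  rw [hσ, ← sub_nonneg, ← Finset.sum_sub_distrib, Fintype.sum_eq_add i j hij] at hle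
  · simp only [Equiv.Perm.mul_apply, Equiv.swap_apply_left, Equiv.swap_apply_right] at hle
    nlinarith
  · rintro k ⟨hki, hkj⟩
    simp [Equiv.Perm.mul_apply, Equiv.swap_apply_of_ne_of_ne hki hkj]

lemma sum_weight_rate_le {d p D : Fin N → ℝ} (hp : ∀ i, 0 ≤ p i) {σ : Equiv.Perm (Fin N)}
    (hσ : sortedSum d = ∑ i, weight N (σ i) * d i)
    (hD : ∀ i, D i ≤ -p i ∨ ∃ j, d j < d i ∧ D i ≤ -p i + p j) :
    ∑ i, weight N (σ i) * D i ≤ -(((2 * N : ℝ)⁻¹) ^ N / 2 * ∑ i, p i) := by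
  set S := ∑ i, weight N (σ i) * p i with hS
  have hterm0 : ∀ j, 0 ≤ weight N (σ j) * p j := fun j => mul_nonneg (weight_pos _).le (hp j)
  have hle : ∀ j, weight N (σ j) * p j ≤ S := fun j =>
    Finset.single_le_sum (f := fun j => weight N (σ j) * p j) (fun j _ => hterm0 j)
      (Finset.mem_univ j)
  have hterm : ∀ i ∈ Finset.univ,
      weight N (σ i) * D i ≤ -(weight N (σ i) * p i) + (2 * N : ℝ)⁻¹ * S := fun i _ => by
    have hw := weight_pos (σ i)
    have hc := inv_two_mul_pos i
    have hS0 : 0 ≤ S := (hterm0 i).trans (hle i)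
    rcases hD i with h | ⟨j, hj, h⟩
    · nlinarith [mul_nonneg hc.le hS0, mul_le_mul_of_nonneg_left h hw.le]
    · have h1 := mul_le_mul_of_nonneg_left h hw.le
      have h2 := mul_le_mul_of_nonneg_right
        (weight_le_of_lt (lt_of_sortedSum_eq hσ hj)) (hp j)
      have h3 := mul_le_mul_of_nonneg_left (hle j) hc.le
      linarith
  have hhalf : S / 2 ≥ ((2 * N : ℝ)⁻¹) ^ N / 2 * ∑ i, p i := by
    rw [div_mul_eq_mul_div, Finset.mul_sum]
    have : ∑ i, ((2 * N : ℝ)⁻¹) ^ N * p i ≤ S :=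
      Finset.sum_le_sum fun i _ => mul_le_mul_of_nonneg_right (le_weight _) (hp i)
    linarith
  have hcount : (N : ℝ) * ((2 * N : ℝ)⁻¹ * S) ≤ S / 2 := by
    rcases Nat.eq_zero_or_pos N with rfl | hN
    · simp [hS]
    · have : (N : ℝ) ≠ 0 := by positivity
      apply le_of_eq
      field_simp
  have hsum := Finset.sum_le_sum hterm
  rw [Finset.sum_add_distrib, Finset.sum_neg_distrib, Finset.sum_const, Finset.card_univ,
    Fintype.card_fin, nsmul_eq_mul, ← hS] at hsum
  linarith

end Lyapunov

lemma deriv_sortedSum_le {n N : ℕ} (hN : 2 ≤ N) {a : ℝ → ℝ}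
    (ha : ∀ r : ℝ, 0 ≤ r → 0 ≤ a r) {x : ℝ → St n N} {t : ℝ}
    (hx : HasDerivAt x (ft1 a (x t)) t)
    (hV : DifferentiableAt ℝ (fun t => sortedSum (nearestDist (x t))) t)
    (hmin : ∀ i k : Fin N, DifferentiableAt ℝ
      (fun t => min (nearestDist (x t) i) (nearestDist (x t) k)) t) :
    deriv (fun t => sortedSum (nearestDist (x t))) t ≤
      -(((2 * N : ℝ)⁻¹) ^ N / 2 * ∑ i, speed a (nearestDist (x t) i)) := by
  have hd : ∀ i, HasDerivAt (fun s => nearestDist (x s) i)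
      (deriv (fun s => nearestDist (x s) i) t) t := fun i => by
    have h := hmin i i
    simp only [min_self] at h
    exact h.hasDerivAt
  have htie : ∀ i k, nearestDist (x t) i = nearestDist (x t) k →
      deriv (fun s => nearestDist (x s) i) t = deriv (fun s => nearestDist (x s) k) t :=
    fun i k hik =>
      ((hmin i k).hasDerivAt.eq_of_le_of_eq (hd i) (fun s => min_le_left _ _)
        (by rw [← hik, min_self])).symm.trans
      ((hmin i k).hasDerivAt.eq_of_le_of_eq (hd k) (fun s => min_le_right _ _)
        (by rw [← hik, min_self]))
  obtain ⟨σ, hσ⟩ := exists_sortedSum_eq (nearestDist (x t))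
  have hsum : HasDerivAt (fun s => ∑ i, weight N (σ i) * nearestDist (x s) i)
      (∑ i, weight N (σ i) * deriv (fun s => nearestDist (x s) i) t) t :=
    HasDerivAt.fun_sum fun i _ => (hd i).const_mul (weight N (σ i))
  rw [hV.hasDerivAt.eq_of_le_of_eq hsum (fun s => sortedSum_le _ σ) hσ]
  exact sum_weight_rate_le (fun i => speed_nonneg ha (nearestDist_nonneg _ _)) hσ
    (rate_dichotomy hN a (x t) _ (fun i => rate_le hN ha hx (hd i))
      (fun i => rate_le_of_mutual hN ha hx (hd i)) htie)

section Speed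

variable {a : ℝ → ℝ}

lemma continuousOn_speed (ha : ∃ K : NNReal, LipschitzOnWith K a (Set.Ici 0)) :
    ContinuousOn (speed a) (Ici 0) :=
  ha.choose_spec.continuousOn.mul continuousOn_id

lemma eq_zero_of_speed_eq_zero (ha : ∀ r : ℝ, 0 < r → 0 < a r) {r : ℝ} (hr : 0 ≤ r)
    (h : speed a r = 0) : r = 0 := by
  by_contra hne
  have hpos := lt_of_le_of_ne hr (Ne.symm hne)
  exact (mul_pos (ha r hpos) hpos).ne' h

lemma Ifun_nonneg (ha : ∀ r : ℝ, 0 ≤ r → 0 ≤ a r) {r : ℝ} (hr : 0 ≤ r) : 0 ≤ Ifun a r :=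
  intervalIntegral.integral_nonneg hr fun s hs => mul_nonneg (ha s hs.1) hs.1

lemma Wfun_eq_zero {n N : ℕ} (ha : ∀ r : ℝ, 0 ≤ r → 0 ≤ a r) (x : St n N)
    (hx : ∀ i, ∃ j, j ≠ i ∧ x i = x j) : Wfun a x = 0 := by
  refine Finset.sum_eq_zero fun i _ => ?_
  obtain ⟨j, hj, hij⟩ := hx i
  have h0 : ∀ k : {k : Fin N // k ≠ i}, 0 ≤ Ifun a ‖x i - x (k : Fin N)‖ :=
    fun k => Ifun_nonneg ha (norm_nonneg _)
  refine le_antisymm ?_ (Real.iInf_nonneg h0)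
  refine (ciInf_le ⟨0, by rintro _ ⟨k, rfl⟩; exact h0 k⟩ (⟨j, hj⟩ : {k : Fin N // k ≠ i})).trans ?_
  simp [hij, Ifun]

end Speed

namespace IsCaratheodorySolutionOn

section General

variable {E : Type*} [NormedAddCommGroup E] [NormedSpace ℝ E] [CompleteSpace E]
  {f : E → E} {x : ℝ → E}

lemma integrableOn_Icc (hx : IsCaratheodorySolutionOn f x (Ici 0)) {s : ℝ} (hs : 0 ≤ s) (T : ℝ) :
    IntegrableOn (fun s => f (x s)) (Icc s T) :=
  hx.1.integrableOn_compact_subset (fun _ h => hs.trans h.1) isCompact_Icc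

lemma intervalIntegrable (hx : IsCaratheodorySolutionOn f x (Ici 0)) {s t : ℝ} (hs : 0 ≤ s)
    (ht : 0 ≤ t) : IntervalIntegrable (fun s => f (x s)) volume s t :=
  intervalIntegrable_iff.2 ((hx.integrableOn_Icc (le_min hs ht) (max s t)).mono_set
    Ioc_subset_Icc_self)

lemma eq_add_integral (hx : IsCaratheodorySolutionOn f x (Ici 0)) {t : ℝ} (ht : 0 ≤ t) :
    x t = x 0 + ∫ s in (0 : ℝ)..t, f (x s) := by
  rw [intervalIntegral.integral_of_le ht]
  exact hx.2 t ht

lemma sub_eq_integral (hx : IsCaratheodorySolutionOn f x (Ici 0)) {s t : ℝ} (hs : 0 ≤ s)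
    (ht : 0 ≤ t) : x t - x s = ∫ r in s..t, f (x r) := by
  rw [hx.eq_add_integral hs, hx.eq_add_integral ht, add_sub_add_left_eq_sub]
  exact intervalIntegral.integral_interval_sub_left (hx.intervalIntegrable le_rfl ht)
    (hx.intervalIntegrable le_rfl hs)

lemma continuousOn_Icc (hx : IsCaratheodorySolutionOn f x (Ici 0)) (T : ℝ) :
    ContinuousOn x (Icc 0 T) :=
  ((continuousOn_const (c := x 0)).add (intervalIntegral.continuousOn_primitive
    (hx.integrableOn_Icc le_rfl T))).congr fun t ht => hx.2 t ht.1

lemma continuousOn (hx : IsCaratheodorySolutionOn f x (Ici 0)) : ContinuousOn x (Ici 0) := by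
  intro t ht
  refine ((hx.continuousOn_Icc (t + 1)) t ⟨ht, by linarith⟩).mono_of_mem_nhdsWithin ?_
  rw [← Ici_inter_Iic]
  exact inter_mem self_mem_nhdsWithin
    (mem_nhdsWithin_of_mem_nhds (Iic_mem_nhds (by linarith)))

lemma lipschitzOnWith (hx : IsCaratheodorySolutionOn f x (Ici 0)) {T : ℝ} {C : NNReal}
    (hC : ∀ s ∈ Icc 0 T, ‖f (x s)‖ ≤ C) : LipschitzOnWith C x (Icc 0 T) := by
  refine LipschitzOnWith.of_dist_le_mul fun s hs t ht => ?_
  rw [dist_eq_norm, hx.sub_eq_integral ht.1 hs.1, dist_eq_norm]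
  refine intervalIntegral.norm_integral_le_of_norm_le_const fun r hr => hC r ?_
  have hr' := uIoc_subset_uIcc hr
  exact uIcc_subset_Icc ht hs hr'

lemma ae_hasDerivAt (hx : IsCaratheodorySolutionOn f x (Ici 0)) {T : ℝ} (hT : 0 ≤ T) :
    ∀ᵐ t, t ∈ Ioo 0 T → HasDerivAt x (f (x t)) t := by
  filter_upwards [(hx.intervalIntegrable le_rfl hT).ae_hasDerivAt_integral] with t ht htT
  have h := (ht (by rw [uIcc_of_le hT]; exact Ioo_subset_Icc_self htT) 0
    left_mem_uIcc).const_add (x 0)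
  refine h.congr_of_eventuallyEq ?_
  filter_upwards [Ioi_mem_nhds htT.1] with s hs
  exact hx.eq_add_integral (le_of_lt hs)

end General

variable {n N : ℕ} {a : ℝ → ℝ} {x : ℝ → St n N}

lemma continuousOn_speed (hN : 2 ≤ N)
    (ha_lip : ∃ K : NNReal, LipschitzOnWith K a (Set.Ici 0))
    (hx : IsCaratheodorySolutionOn (ft1 a) x (Ici 0)) (i : Fin N) :
    ContinuousOn (fun t => speed a (nearestDist (x t) i)) (Ici 0) :=
  (_root_.continuousOn_speed ha_lip).comp
    ((lipschitzWith_nearestDist hN i).continuous.comp_continuousOn hx.continuousOn)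
    fun _ _ => nearestDist_nonneg _ _

lemma exists_lipschitzOnWith (hN : 2 ≤ N)
    (ha_lip : ∃ K : NNReal, LipschitzOnWith K a (Set.Ici 0))
    (ha_nonneg : ∀ r : ℝ, 0 ≤ r → 0 ≤ a r)
    (hx : IsCaratheodorySolutionOn (ft1 a) x (Ici 0)) (T : ℝ) :
    ∃ C : NNReal, LipschitzOnWith C x (Icc 0 T) := by
  have hcont : ContinuousOn (fun t => ∑ i, speed a (nearestDist (x t) i)) (Icc 0 T) :=
    continuousOn_finsetSum _ fun i _ =>
      (hx.continuousOn_speed hN ha_lip i).mono Icc_subset_Ici_self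
  obtain ⟨C, hC⟩ := isCompact_Icc.exists_bound_of_continuousOn hcont
  refine ⟨C.toNNReal, hx.lipschitzOnWith fun s hs => ?_⟩
  have h0 : ∀ i, 0 ≤ speed a (nearestDist (x s) i) :=
    fun i => speed_nonneg ha_nonneg (nearestDist_nonneg _ _)
  have hle : ‖ft1 a (x s)‖ ≤ ∑ i, speed a (nearestDist (x s) i) := by
    refine (pi_norm_le_iff_of_nonneg (Finset.sum_nonneg fun i _ => h0 i)).2 fun i => ?_
    rw [norm_ft1 ha_nonneg]
    exact Finset.single_le_sum (f := fun i => speed a (nearestDist (x s) i))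
      (fun i _ => h0 i) (Finset.mem_univ i)
  exact hle.trans ((le_abs_self _).trans ((hC s hs).trans (Real.le_coe_toNNReal C)))

lemma absolutelyContinuousOnInterval_comp (hN : 2 ≤ N)
    (ha_lip : ∃ K : NNReal, LipschitzOnWith K a (Set.Ici 0))
    (ha_nonneg : ∀ r : ℝ, 0 ≤ r → 0 ≤ a r)
    (hx : IsCaratheodorySolutionOn (ft1 a) x (Ici 0)) {T : ℝ} (hT : 0 ≤ T)
    {K : NNReal} {G : St n N → ℝ} (hG : LipschitzWith K G) :
    AbsolutelyContinuousOnInterval (fun t => G (x t)) 0 T := by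
  obtain ⟨C, hC⟩ := hx.exists_lipschitzOnWith hN ha_lip ha_nonneg T
  rw [← uIcc_of_le hT] at hC
  exact (hG.comp_lipschitzOnWith hC).absolutelyContinuousOnInterval

lemma absolutelyContinuousOnInterval_sortedSum (hN : 2 ≤ N)
    (ha_lip : ∃ K : NNReal, LipschitzOnWith K a (Set.Ici 0))
    (ha_nonneg : ∀ r : ℝ, 0 ≤ r → 0 ≤ a r)
    (hx : IsCaratheodorySolutionOn (ft1 a) x (Ici 0)) {T : ℝ} (hT : 0 ≤ T) :
    AbsolutelyContinuousOnInterval (fun t => sortedSum (nearestDist (x t))) 0 T := by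
  exact hx.absolutelyContinuousOnInterval_comp hN ha_lip ha_nonneg hT
    (G := fun y => sortedSum (nearestDist y)) (lipschitzWith_sortedSum_nearestDist hN)

lemma ae_deriv_sortedSum_le (hN : 2 ≤ N)
    (ha_lip : ∃ K : NNReal, LipschitzOnWith K a (Set.Ici 0))
    (ha_nonneg : ∀ r : ℝ, 0 ≤ r → 0 ≤ a r)
    (hx : IsCaratheodorySolutionOn (ft1 a) x (Ici 0)) {T : ℝ} (hT : 0 ≤ T) :
    ∀ᵐ t, t ∈ Ioo 0 T → deriv (fun t => sortedSum (nearestDist (x t))) t ≤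
      -(((2 * N : ℝ)⁻¹) ^ N / 2 * ∑ i, speed a (nearestDist (x t) i)) := by
  have hmin : ∀ i k : Fin N, AbsolutelyContinuousOnInterval
      (fun t => min (nearestDist (x t) i) (nearestDist (x t) k)) 0 T := fun i k =>
    hx.absolutelyContinuousOnInterval_comp hN ha_lip ha_nonneg hT
      (G := fun y => min (nearestDist y i) (nearestDist y k))
      ((lipschitzWith_nearestDist hN i).fun_min_same (lipschitzWith_nearestDist hN k))
  have hminae : ∀ᵐ t, ∀ i k : Fin N, t ∈ uIcc 0 T → DifferentiableAt ℝ
      (fun t => min (nearestDist (x t) i) (nearestDist (x t) k)) t :=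
    ae_all_iff.2 fun i => ae_all_iff.2 fun k => (hmin i k).ae_differentiableAt
  filter_upwards [hx.ae_hasDerivAt hT, hminae,
    (hx.absolutelyContinuousOnInterval_sortedSum hN ha_lip ha_nonneg hT).ae_differentiableAt]
    with t hxt hmint hVt ht
  have ht' : t ∈ uIcc 0 T := by rw [uIcc_of_le hT]; exact Ioo_subset_Icc_self ht
  exact deriv_sortedSum_le hN ha_nonneg (hxt ht) (hVt ht') fun i k => hmint i k ht'

lemma integral_sum_speed_le (hN : 2 ≤ N)
    (ha_lip : ∃ K : NNReal, LipschitzOnWith K a (Set.Ici 0))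
    (ha_nonneg : ∀ r : ℝ, 0 ≤ r → 0 ≤ a r)
    (hx : IsCaratheodorySolutionOn (ft1 a) x (Ici 0)) {T : ℝ} (hT : 0 ≤ T) :
    ((2 * N : ℝ)⁻¹) ^ N / 2 * ∫ t in (0 : ℝ)..T, ∑ i, speed a (nearestDist (x t) i) ≤
      sortedSum (nearestDist (x 0)) := by
  have hAC := hx.absolutelyContinuousOnInterval_sortedSum hN ha_lip ha_nonneg hT
  have hint : IntervalIntegrable (fun t => ∑ i, speed a (nearestDist (x t) i)) volume 0 T := by
    refine ContinuousOn.intervalIntegrable ?_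
    rw [uIcc_of_le hT]
    exact continuousOn_finsetSum _ fun i _ =>
      (hx.continuousOn_speed hN ha_lip i).mono Icc_subset_Ici_self
  have hderiv' : (fun t => deriv (fun t => sortedSum (nearestDist (x t))) t)
      ≤ᵐ[volume.restrict (Icc 0 T)]
      fun t => -(((2 * N : ℝ)⁻¹) ^ N / 2 * ∑ i, speed a (nearestDist (x t) i)) := by
    rw [← restrict_Ioo_eq_restrict_Icc]
    exact (ae_restrict_iff' measurableSet_Ioo).2
      (hx.ae_deriv_sortedSum_le hN ha_lip ha_nonneg hT)
  have hmono := intervalIntegral.integral_mono_ae_restrict hT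
    hAC.intervalIntegrable_deriv (hint.const_mul (((2 * N : ℝ)⁻¹) ^ N / 2)).neg hderiv'
  simp only [Pi.neg_apply] at hmono
  rw [hAC.integral_deriv_eq_sub, intervalIntegral.integral_neg,
    intervalIntegral.integral_const_mul] at hmono
  have := sortedSum_nonneg (nearestDist_nonneg (x T))
  linarith

lemma integrableOn_speed (hN : 2 ≤ N)
    (ha_lip : ∃ K : NNReal, LipschitzOnWith K a (Set.Ici 0))
    (ha_nonneg : ∀ r : ℝ, 0 ≤ r → 0 ≤ a r)
    (hx : IsCaratheodorySolutionOn (ft1 a) x (Ici 0)) (i : Fin N) :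
    IntegrableOn (fun t => speed a (nearestDist (x t) i)) (Ioi 0) := by
  have hc : 0 < ((2 * N : ℝ)⁻¹) ^ N / 2 := half_pos (pow_pos (inv_two_mul_pos i) _)
  have hcont := hx.continuousOn_speed hN ha_lip
  have h0 : ∀ t j, 0 ≤ speed a (nearestDist (x t) j) :=
    fun t j => speed_nonneg ha_nonneg (nearestDist_nonneg _ _)
  refine integrableOn_Ioi_of_intervalIntegral_norm_bounded
    (sortedSum (nearestDist (x 0)) / (((2 * N : ℝ)⁻¹) ^ N / 2)) 0 (b := id) (l := atTop)
    (fun T => (((hcont i).mono Icc_subset_Ici_self).integrableOn_compact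
      isCompact_Icc).mono_set Ioc_subset_Icc_self) tendsto_id ?_
  filter_upwards [eventually_ge_atTop 0] with T hT
  rw [le_div_iff₀' hc]
  refine le_trans (mul_le_mul_of_nonneg_left ?_ hc.le)
    (hx.integral_sum_speed_le hN ha_lip ha_nonneg hT)
  have hsub : uIcc 0 T ⊆ Ici 0 := by rw [uIcc_of_le hT]; exact Icc_subset_Ici_self
  refine intervalIntegral.integral_mono_on hT ((hcont i).mono hsub).norm.intervalIntegrable
    (ContinuousOn.intervalIntegrable
      (continuousOn_finsetSum _ fun j _ => (hcont j).mono hsub)) fun t _ => ?_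
  rw [Real.norm_of_nonneg (h0 t i)]
  exact Finset.single_le_sum (f := fun j => speed a (nearestDist (x t) j))
    (fun j _ => h0 t j) (Finset.mem_univ i)

lemma exists_tendsto (hN : 2 ≤ N)
    (ha_lip : ∃ K : NNReal, LipschitzOnWith K a (Set.Ici 0))
    (ha_nonneg : ∀ r : ℝ, 0 ≤ r → 0 ≤ a r)
    (hx : IsCaratheodorySolutionOn (ft1 a) x (Ici 0)) :
    ∃ y : St n N, Tendsto x atTop (nhds y) := by
  have hmeas : AEStronglyMeasurable (fun t => ft1 a (x t)) (volume.restrict (Ioi 0)) :=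
    (hx.1.mono_set Ioi_subset_Ici_self).aestronglyMeasurable
  have hint : IntegrableOn (fun t => ft1 a (x t)) (Ioi 0) :=
    Integrable.of_eval fun i => (hx.integrableOn_speed hN ha_lip ha_nonneg i).mono'
      ((continuous_apply i).comp_aestronglyMeasurable hmeas)
      (Eventually.of_forall fun t => (norm_ft1 ha_nonneg _ _).le)
  refine ⟨_, ((intervalIntegral_tendsto_integral_Ioi 0 hint tendsto_id).const_add
    (x 0)).congr' ?_⟩
  filter_upwards [eventually_ge_atTop 0] with t ht
  exact (hx.eq_add_integral ht).symm

lemma nearestDist_lim_eq_zero (hN : 2 ≤ N)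
    (ha_lip : ∃ K : NNReal, LipschitzOnWith K a (Set.Ici 0))
    (ha_nonneg : ∀ r : ℝ, 0 ≤ r → 0 ≤ a r) (ha_pos : ∀ r : ℝ, 0 < r → 0 < a r)
    (hx : IsCaratheodorySolutionOn (ft1 a) x (Ici 0)) {y : St n N}
    (hy : Tendsto x atTop (nhds y)) (i : Fin N) : nearestDist y i = 0 := by
  have hd : Tendsto (fun t => nearestDist (x t) i) atTop (nhds (nearestDist y i)) :=
    ((lipschitzWith_nearestDist hN i).continuous.tendsto y).comp hy
  have hs : Tendsto (fun t => speed a (nearestDist (x t) i)) atTop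
      (nhds (speed a (nearestDist y i))) :=
    (_root_.continuousOn_speed ha_lip _ (nearestDist_nonneg y i)).tendsto.comp
      (tendsto_nhdsWithin_iff.2 ⟨hd, Eventually.of_forall fun _ => nearestDist_nonneg _ _⟩)
  refine eq_zero_of_speed_eq_zero ha_pos (nearestDist_nonneg y i)
    (IntegrableAtFilter.eq_zero_of_tendsto
      ⟨Ioi 0, Ioi_mem_atTop 0, hx.integrableOn_speed hN ha_lip ha_nonneg i⟩ ?_ hs)
  intro s hs
  obtain ⟨b, hb⟩ := mem_atTop_sets.1 hs
  rw [← top_le_iff, ← Real.volume_Ici (a := b)]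
  exact measure_mono hb

end IsCaratheodorySolutionOn

/-- For `κ = 1`, every Caratheodory solution of the topological bounded-confidence
model converges to a cluster point. -/
theorem topological_caratheodory_convergence_to_clusters (n N : ℕ) (hn : 1 ≤ n)
    (hN : 2 ≤ N) (a : ℝ → ℝ)
    (ha_lip : ∃ K : NNReal, LipschitzOnWith K a (Set.Ici 0))
    (ha_nonneg : ∀ r : ℝ, 0 ≤ r → 0 ≤ a r)
    (ha_pos : ∀ r : ℝ, 0 < r → 0 < a r)
    (ha_mono : MonotoneOn a (Set.Ici 0))
    (x : ℝ → St n N)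
    (hx : IsCaratheodorySolutionOn (ft1 a) x (Set.Ici 0)) :
    ∃ xlim : St n N,
      (∀ i : Fin N, Tendsto (fun t => x t i) atTop (nhds (xlim i))) ∧
      (∀ i : Fin N, ∃ j : Fin N, j ≠ i ∧ xlim i = xlim j) ∧
      Wfun a xlim = 0 := by
  obtain ⟨y, hy⟩ := hx.exists_tendsto hN ha_lip ha_nonneg
  have hcluster : ∀ i : Fin N, ∃ j : Fin N, j ≠ i ∧ y i = y j := fun i =>
    ⟨gamma y i, gamma_ne hN y i, (sub_eq_zero.1 (norm_eq_zero.1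
      (hx.nearestDist_lim_eq_zero hN ha_lip ha_nonneg ha_pos hy i))).symm⟩
  exact ⟨y, tendsto_pi_nhds.1 hy, hcluster, Wfun_eq_zero ha_nonneg y hcluster⟩
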